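/- arXiv:2106.04282 — 3 statements merged into one kernel-verified Lean document; each statement's English description precedes it below -/
import Mathlib

section
/- Let X', γ, ρ > 0, and define X = ρ(X'+γ)/(X'+γ+ρ) and g = X'/(X'+γ). Then for all a, b ∈ ℝ, the function x ↦ X'(a+b+x)² + γ(a+x)² + ρx² has unique minimizer x = −(X/ρ)(a + g·b), and its minimum value equals X·(a + g·b)² + (X'γ/(X'+γ))·b²; in particular the minimum value is X·(a + g·b)² plus a quantity depending only on b (not on a). -/
/-- Let `X', γ, ρ > 0`, `X = ρ(X'+γ)/(X'+γ+ρ)`, `g = X'/(X'+γ)`.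
Then for all `a, b`, the function `x ↦ X'(a+b+x)² + γ(a+x)² + ρx²` has unique
minimizer `x = −(X/ρ)(a + g·b)` and minimum value `X·(a+g·b)² + (X'γ/(X'+γ))·b²`;
in particular the minimum is `X·(a+g·b)²` plus a quantity depending only on `b`. -/
theorem stmt3 (X' γ ρ : ℝ) (hX' : 0 < X') (hγ : 0 < γ) (hρ : 0 < ρ)
    (X g : ℝ) (hX : X = ρ * (X' + γ) / (X' + γ + ρ)) (hg : g = X' / (X' + γ))
    (a b : ℝ) :
    (∀ x : ℝ, x ≠ -(X / ρ) * (a + g * b) →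
      X' * (a + b + -(X / ρ) * (a + g * b)) ^ 2
        + γ * (a + -(X / ρ) * (a + g * b)) ^ 2
        + ρ * (-(X / ρ) * (a + g * b)) ^ 2
      < X' * (a + b + x) ^ 2 + γ * (a + x) ^ 2 + ρ * x ^ 2) ∧
    X' * (a + b + -(X / ρ) * (a + g * b)) ^ 2
        + γ * (a + -(X / ρ) * (a + g * b)) ^ 2
        + ρ * (-(X / ρ) * (a + g * b)) ^ 2
      = X * (a + g * b) ^ 2 + X' * γ / (X' + γ) * b ^ 2 := by
  have key : ∀ x : ℝ, X' * (a + b + x) ^ 2 + γ * (a + x) ^ 2 + ρ * x ^ 2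
      = (X' + γ + ρ) * (x - -(X / ρ) * (a + g * b)) ^ 2
        + (X * (a + g * b) ^ 2 + X' * γ / (X' + γ) * b ^ 2) := by
    intro x
    have h₁ : X' + γ ≠ 0 := by positivity
    have h₂ : X' + γ + ρ ≠ 0 := by positivity
    subst hX hg
    field_simp
    ring
  refine ⟨fun x hx => ?_, ?_⟩
  · rw [key x, key (-(X / ρ) * (a + g * b)), sub_self]
    have hpos : 0 < (x - -(X / ρ) * (a + g * b)) ^ 2 :=
      sq_pos_iff.mpr (sub_ne_zero.mpr hx)
    have := mul_pos (by positivity : 0 < X' + γ + ρ) hpos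
    linarith
  · rw [key, sub_self]
    ring
end

section
/- Let γ, ρ > 0 and P = −γ/2 + √(γρ + γ²/4). For every pair of sequences S, V : ℕ → ℝ satisfying S(t+1) = S(t) + V(t) for all t ∈ ℕ, the sum Σ_{t=0}^∞ (γ·S(t+1)² + ρ·V(t)²), taken in [0, ∞], is at least P·S(0)². -/
open Filter Topology in
/-- A nonnegative storage function `W`, controlled by a constant multiple of the stage cost `c`
and decreasing by at most `c` at each step, bounds the total cost from below by `W 0`. -/
theorem ofReal_le_tsum_of_dissipation {W c : ℕ → ℝ} {K : ℝ} (hc : ∀ t, 0 ≤ c t)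
    (hstep : ∀ t, W t ≤ c t + W (t + 1)) (hW : ∀ t, 0 ≤ W t) (hWc : ∀ t, W (t + 1) ≤ K * c t) :
    ENNReal.ofReal (W 0) ≤ ∑' t, ENNReal.ofReal (c t) := by
  by_cases htop : ∑' t, ENNReal.ofReal (c t) = ⊤
  · simp [htop]
  have hsum : Summable c := by
    simpa [ENNReal.toReal_ofReal, hc] using ENNReal.summable_toReal htop
  rw [← ENNReal.ofReal_tsum_of_nonneg hc hsum]
  apply ENNReal.ofReal_le_ofReal
  have hpartial : ∀ n, W 0 ≤ ∑ t ∈ Finset.range n, c t + W n := by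
    intro n
    induction n with
    | zero => simp
    | succ n ih =>
      rw [Finset.sum_range_succ]
      linarith [hstep n]
  have hlim : Tendsto W atTop (𝓝 0) := by
    rw [← tendsto_add_atTop_iff_nat 1]
    exact squeeze_zero (fun t => hW (t + 1)) hWc
      (by simpa using hsum.tendsto_atTop_zero.const_mul K)
  have htotal := hsum.hasSum.tendsto_sum_nat.add hlim
  rw [add_zero] at htotal
  exact ge_of_tendsto' htotal hpartial

/-- The scalar Riccati equation for integrator dynamics yields the one-step Bellman inequality. -/
theorem bellman_le_of_riccati {γ ρ P : ℝ} (hpos : 0 < γ + P + ρ)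
    (hric : P ^ 2 + γ * P = γ * ρ) (x v : ℝ) :
    P * x ^ 2 ≤ γ * (x + v) ^ 2 + ρ * v ^ 2 + P * (x + v) ^ 2 := by
  have key : (γ + P + ρ) * (γ * (x + v) ^ 2 + ρ * v ^ 2 + P * (x + v) ^ 2 - P * x ^ 2)
      = ((γ + P + ρ) * (x + v) - ρ * x) ^ 2 := by
    linear_combination (-x ^ 2) * hric
  exact sub_nonneg.mp (nonneg_of_mul_nonneg_right (key ▸ sq_nonneg _) hpos)

/-- Lower bound for scalar infinite-horizon LQR with integrator
dynamics: for `γ, ρ > 0`, `P = −γ/2 + √(γρ + γ²/4)`, and any sequences `S, V : ℕ → ℝ`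
with `S(t+1) = S(t) + V(t)`, the total cost `Σ_{t=0}^∞ (γS(t+1)² + ρV(t)²)`,
taken in `[0, ∞]`, is at least `P·S(0)²`. -/
theorem stmt7 (γ ρ : ℝ) (hγ : 0 < γ) (hρ : 0 < ρ)
    (P : ℝ) (hP : P = -γ / 2 + Real.sqrt (γ * ρ + γ ^ 2 / 4))
    (S V : ℕ → ℝ) (hdyn : ∀ t : ℕ, S (t + 1) = S t + V t) :
    ENNReal.ofReal (P * S 0 ^ 2)
      ≤ ∑' t : ℕ, ENNReal.ofReal (γ * S (t + 1) ^ 2 + ρ * V t ^ 2) := by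
  have hsq := Real.sq_sqrt (show 0 ≤ γ * ρ + γ ^ 2 / 4 by positivity)
  have hric : P ^ 2 + γ * P = γ * ρ := by
    rw [hP]
    linear_combination hsq
  have hP0 : 0 ≤ P := by
    have : γ / 2 ≤ Real.sqrt (γ * ρ + γ ^ 2 / 4) :=
      Real.le_sqrt_of_sq_le (by nlinarith [mul_pos hγ hρ])
    linarith
  refine ofReal_le_tsum_of_dissipation (W := fun t => P * S t ^ 2) (K := P / γ)
    (fun t => by positivity) (fun t => ?_) (fun t => by positivity) (fun t => ?_)
  · simpa only [hdyn t] using bellman_le_of_riccati (by positivity) hric (S t) (V t)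
  · calc P * S (t + 1) ^ 2 = P / γ * (γ * S (t + 1) ^ 2) := by field_simp
      _ ≤ P / γ * (γ * S (t + 1) ^ 2 + ρ * V t ^ 2) := by
        gcongr
        exact le_add_of_nonneg_right (by positivity)
end

section
/- Let γ, ρ > 0 and P = −γ/2 + √(γρ + γ²/4). Let S, V : ℕ → ℝ satisfy the feedback law V(t) = −((γ+P)/(γ+P+ρ))·S(t) and the dynamics S(t+1) = S(t) + V(t) for all t ∈ ℕ. Then the series Σ_{t=0}^∞ (γ·S(t+1)² + ρ·V(t)²) converges and its sum equals P·S(0)². -/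
/-- Achievability for scalar infinite-horizon LQR with integrator
dynamics: for `γ, ρ > 0`, `P = −γ/2 + √(γρ + γ²/4)`, if `S, V : ℕ → ℝ` satisfy the
feedback law `V(t) = −((γ+P)/(γ+P+ρ))·S(t)` and `S(t+1) = S(t) + V(t)`, then the
series `Σ_{t=0}^∞ (γS(t+1)² + ρV(t)²)` converges with sum `P·S(0)²`. -/
theorem stmt8 (γ ρ : ℝ) (hγ : 0 < γ) (hρ : 0 < ρ)
    (P : ℝ) (hP : P = -γ / 2 + Real.sqrt (γ * ρ + γ ^ 2 / 4))
    (S V : ℕ → ℝ)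
    (hfb : ∀ t : ℕ, V t = -((γ + P) / (γ + P + ρ)) * S t)
    (hdyn : ∀ t : ℕ, S (t + 1) = S t + V t) :
    HasSum (fun t : ℕ => γ * S (t + 1) ^ 2 + ρ * V t ^ 2) (P * S 0 ^ 2) := by
  have hsq : Real.sqrt (γ * ρ + γ ^ 2 / 4) ^ 2 = γ * ρ + γ ^ 2 / 4 :=
    Real.sq_sqrt (by positivity)
  have hPpos : 0 < P := by
    have : γ / 2 < Real.sqrt (γ * ρ + γ ^ 2 / 4) :=
      Real.lt_sqrt_of_sq_lt (by nlinarith [mul_pos hγ hρ])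
    linarith
  have hric : P ^ 2 + γ * P = γ * ρ := by
    have hs : Real.sqrt (γ * ρ + γ ^ 2 / 4) = P + γ / 2 := by linarith
    rw [hs] at hsq
    linarith
  have hD : 0 < γ + P + ρ := by positivity
  obtain ⟨r, hr⟩ : ∃ r, r = ρ / (γ + P + ρ) := ⟨_, rfl⟩
  have hr0 : 0 < r := hr ▸ div_pos hρ hD
  have hr1 : r < 1 := by
    rw [hr, div_lt_one hD]
    linarith
  have hr2 : r ^ 2 < 1 := by nlinarith
  have hgain : (γ + P) / (γ + P + ρ) = 1 - r := by
    rw [hr]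
    field_simp
    ring
  have hstep : ∀ t, S (t + 1) = r * S t := fun t => by
    rw [hdyn, hfb, hgain]
    ring
  have hS : ∀ t, S t = r ^ t * S 0 := fun t => by
    induction t with
    | zero => simp
    | succ t ih => rw [hstep, ih]; ring
  have hcost : γ * r ^ 2 + ρ * (1 - r) ^ 2 = P * (1 - r ^ 2) := by
    have hrD : r * (γ + P + ρ) = ρ := by
      rw [hr]
      field_simp
    have hrP : r * (γ + P) = P := by
      have : (r * (γ + P) - P) * (γ + P + ρ) = 0 := by
        linear_combination (γ + P) * hrD - hric
      linarith [(mul_eq_zero.mp this).resolve_right hD.ne']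
    linear_combination (r - 1) * hrD + hrP
  have hgeom := (hasSum_geometric_of_lt_one (sq_nonneg r) hr2).mul_left (P * (1 - r ^ 2) * S 0 ^ 2)
  have hterm : (fun t => γ * S (t + 1) ^ 2 + ρ * V t ^ 2) =
      fun t => P * (1 - r ^ 2) * S 0 ^ 2 * (r ^ 2) ^ t := by
    funext t
    rw [hstep, hfb, hgain, hS t, ← hcost]
    ring
  have hsum : P * S 0 ^ 2 = P * (1 - r ^ 2) * S 0 ^ 2 * (1 - r ^ 2)⁻¹ := by
    have : 1 - r ^ 2 ≠ 0 := by linarith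
    field_simp
  rw [hterm, hsum]
  exact hgeom
end
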